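/- Let n ≥ 2 be even and r > 0. For an i.i.d. sample S = ((x₁,y₁),…,(xₙ,yₙ)) ~ Dⁿ, the expected uniform deviation over the L2 ball satisfies E_S[ sup_{μ : ‖μ‖₂ ≤ r} ( R(μ) − R̂_S(μ) ) ] ≤ (4/n) · E[ sup_{μ : ‖μ‖₂ ≤ r} Σ_{i=1}^{n/2} εᵢ ⟨μ, z(xᵢ, x_{n/2+i})⟩ ], where ε₁,…,ε_{n/2} are i.i.d. Rademacher random variables independent of S. Consequently this expected uniform deviation is at most 2 r ‖κ‖₂ √(2/n). -/

import Mathlib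

open MeasureTheory Finset

noncomputable section

/-- The ±1 real value of a Boolean label: `true ↦ 1`, `false ↦ -1`.
We encode the label space {−1, 1} by `Bool`. -/
def sgn (b : Bool) : ℝ := if b then 1 else -1

/-- The Euclidean (L2) norm on ℝᵖ. -/
def l2norm {p : ℕ} (μ : Fin p → ℝ) : ℝ := Real.sqrt (∑ i, μ i ^ 2)

/-- The L1 norm on ℝᵖ. -/
def l1norm {p : ℕ} (μ : Fin p → ℝ) : ℝ := ∑ i, |μ i|

/-- The L∞ (supremum) norm on ℝᵖ. -/
def linfnorm {p : ℕ} (μ : Fin p → ℝ) : ℝ := ⨆ i, |μ i|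

/-- The standard inner product on ℝᵖ. -/
def ip {p : ℕ} (μ v : Fin p → ℝ) : ℝ := ∑ i, μ i * v i

/-- The K-space feature map `z(x,x') = (K₁(x,x'),…,K_p(x,x'))`. -/
def zmap {X : Type*} {p : ℕ} (K : Fin p → X → X → ℝ) (x x' : X) : Fin p → ℝ :=
  fun i => K i x x'

/-- The pairwise hinge loss `ℓ(μ, (x,y), (x',y')) = max(0, 1 − y y' ⟨μ, z(x,x')⟩)`. -/
def hinge {X : Type*} {p : ℕ} (K : Fin p → X → X → ℝ) (μ : Fin p → ℝ)
    (w w' : X × Bool) : ℝ :=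
  max 0 (1 - sgn w.2 * sgn w'.2 * ip μ (zmap K w.1 w'.1))

/-- The empirical risk `R̂_S(μ) = (2/(n(n−1))) Σ_{1≤i<j≤n} ℓ(μ, (xᵢ,yᵢ), (xⱼ,yⱼ))`. -/
def empRisk {X : Type*} {p n : ℕ} (K : Fin p → X → X → ℝ)
    (S : Fin n → X × Bool) (μ : Fin p → ℝ) : ℝ :=
  (2 / ((n : ℝ) * ((n : ℝ) - 1))) *
    ∑ i : Fin n, ∑ j : Fin n, if i < j then hinge K μ (S i) (S j) else 0

/-- The true risk `R(μ) = E_{((x,y),(x',y')) ~ D×D}[max(0, 1 − y y' ⟨μ, z(x,x')⟩)]`. -/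
def trueRisk {X : Type*} [MeasurableSpace X] {p : ℕ} (K : Fin p → X → X → ℝ)
    (D : Measure (X × Bool)) (μ : Fin p → ℝ) : ℝ :=
  ∫ w, hinge K μ w.1 w.2 ∂(D.prod D)

/-- Expectation over m i.i.d. Rademacher random variables (uniform on {−1,+1}),
encoded by Booleans mapped to ±1 via `sgn`. -/
def radE {m : ℕ} (f : (Fin m → Bool) → ℝ) : ℝ :=
  (∑ ε : Fin m → Bool, f ε) / 2 ^ m

lemma abs_sgn (b : Bool) : |sgn b| = 1 := by cases b <;> simp [sgn]

lemma sgn_not (b : Bool) : sgn (!b) = -sgn b := by cases b <;> simp [sgn]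

lemma radE_zero (f : (Fin 0 → Bool) → ℝ) : radE f = f Fin.elim0 := by
  unfold radE
  rw [Fintype.sum_subsingleton _ Fin.elim0]
  simp

lemma radE_succ {m : ℕ} (f : (Fin (m + 1) → Bool) → ℝ) :
    radE f = (radE (fun ε => f (Fin.cons true ε)) + radE (fun ε => f (Fin.cons false ε))) / 2 := by
  have h : ∑ ε, f ε = ∑ ε : Fin m → Bool, f (Fin.cons true ε)
      + ∑ ε : Fin m → Bool, f (Fin.cons false ε) := by
    rw [← (Fin.consEquiv (fun _ => Bool)).sum_comp, Fintype.sum_prod_type]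
    simp [Fin.consEquiv]
  simp only [radE, h, pow_succ]
  field_simp

lemma radE_mono {m : ℕ} {f g : (Fin m → Bool) → ℝ} (h : ∀ ε, f ε ≤ g ε) : radE f ≤ radE g := by
  unfold radE
  gcongr
  exact h _

lemma radE_add {m : ℕ} (f g : (Fin m → Bool) → ℝ) :
    radE (fun ε => f ε + g ε) = radE f + radE g := by
  simp only [radE, sum_add_distrib, add_div]

lemma radE_const_mul {m : ℕ} (c : ℝ) (f : (Fin m → Bool) → ℝ) :
    radE (fun ε => c * f ε) = c * radE f := by
  simp only [radE, ← mul_sum, mul_div_assoc]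

lemma radE_const {m : ℕ} (c : ℝ) : radE (fun _ : Fin m → Bool => c) = c := by
  simp [radE]

lemma radE_not {m : ℕ} (f : (Fin m → Bool) → ℝ) :
    radE (fun ε => f (fun i => !(ε i))) = radE f := by
  unfold radE
  congr 1
  exact (Equiv.piCongrRight fun _ : Fin m => Equiv.boolNot).sum_comp f

/-- Second moment of a Rademacher sum. -/
lemma radE_sq {m : ℕ} (c : Fin m → ℝ) (g : ℝ) :
    radE (fun ε => (g + ∑ i, sgn (ε i) * c i) ^ 2) = g ^ 2 + ∑ i, c i ^ 2 := by
  induction m generalizing g with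
  | zero => simp [radE_zero]
  | succ m ih =>
    rw [radE_succ]
    simp only [Fin.sum_univ_succ, Fin.cons_zero, Fin.cons_succ, ← add_assoc, ih]
    simp only [sgn]
    norm_num
    ring

/-- Jensen's inequality for the square root under a Rademacher average. -/
lemma radE_sqrt_le {m : ℕ} (f : (Fin m → Bool) → ℝ) (hf : ∀ ε, 0 ≤ f ε) :
    radE (fun ε => √(f ε)) ≤ √(radE f) := by
  apply Real.le_sqrt_of_sq_le
  have h := sum_mul_sq_le_sq_mul_sq univ (fun _ : Fin m → Bool => (1 : ℝ)) (fun ε => √(f ε))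
  simp only [one_mul, one_pow, sum_const, card_univ, Fintype.card_pi, Fintype.card_bool,
    prod_const, Fintype.card_fin, nsmul_eq_mul, mul_one, Real.sq_sqrt (hf _)] at h
  unfold radE
  rw [div_pow, div_le_div_iff₀ (by positivity) (by positivity)]
  push_cast at h
  nlinarith [pow_pos (two_pos : (0 : ℝ) < 2) m]

/-- One step of the contraction principle. -/
lemma ciSup_add_ciSup_contract {T : Type*} [Nonempty T] (G u v : T → ℝ)
    (huv : ∀ s t, |v s - v t| ≤ |u s - u t|)
    (hp : BddAbove (Set.range fun t => G t + u t))
    (hm : BddAbove (Set.range fun t => G t - u t)) :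
    (⨆ t, (G t + v t)) + (⨆ t, (G t - v t)) ≤ (⨆ t, (G t + u t)) + ⨆ t, (G t - u t) := by
  have key : ∀ s t, (G s + v s) + (G t - v t) ≤ (⨆ t, (G t + u t)) + ⨆ t, (G t - u t) := by
    intro s t
    have h1 : G s + u s ≤ _ := le_ciSup hp s
    have h2 : G t - u t ≤ _ := le_ciSup hm t
    have h3 : G t + u t ≤ _ := le_ciSup hp t
    have h4 : G s - u s ≤ _ := le_ciSup hm s
    have h5 := (le_abs_self _).trans (huv s t)
    rcases abs_cases (u s - u t) with h | h <;> linarith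
  have h1 : ∀ t, (⨆ s, (G s + v s)) ≤
      ((⨆ t, (G t + u t)) + ⨆ t, (G t - u t)) - (G t - v t) :=
    fun t => ciSup_le fun s => by linarith [key s t]
  have h2 : (⨆ t, (G t - v t)) ≤
      ((⨆ t, (G t + u t)) + ⨆ t, (G t - u t)) - ⨆ s, (G s + v s) :=
    ciSup_le fun t => by linarith [h1 t]
  linarith

lemma abs_signed_sum_le {m : ℕ} (ε : Fin m → Bool) (a : Fin m → ℝ) {C : ℝ}
    (h : ∀ i, |a i| ≤ C) : |∑ i, sgn (ε i) * a i| ≤ m * C := by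
  refine (abs_sum_le_sum_abs _ _).trans ?_
  calc ∑ i, |sgn (ε i) * a i| ≤ ∑ _i : Fin m, C :=
        sum_le_sum fun i _ => by rw [abs_mul, abs_sgn, one_mul]; exact h i
    _ = m * C := by simp

lemma bddAbove_of_abs_le {T : Type*} {f : T → ℝ} {C : ℝ} (h : ∀ t, |f t| ≤ C) :
    BddAbove (Set.range f) := ⟨C, by rintro _ ⟨t, rfl⟩; exact (abs_le.1 (h t)).2⟩

lemma abs_ciSup_le {T : Type*} [Nonempty T] {f : T → ℝ} {C : ℝ} (h : ∀ t, |f t| ≤ C) :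
    |⨆ t, f t| ≤ C := by
  rw [abs_le]
  refine ⟨?_, ciSup_le fun t => (abs_le.1 (h t)).2⟩
  obtain ⟨t⟩ := ‹Nonempty T›
  exact (abs_le.1 (h t)).1.trans (le_ciSup (bddAbove_of_abs_le h) t)

/-- The Rademacher contraction principle with an additive offset. -/
lemma radE_contraction {T : Type*} [Nonempty T] {m : ℕ} (u v : T → Fin m → ℝ) (g : T → ℝ)
    {C B : ℝ} (hu : ∀ t i, |u t i| ≤ C) (hg : ∀ t, |g t| ≤ B)
    (hv : ∀ t i, |v t i| ≤ C)
    (huv : ∀ s t i, |v s i - v t i| ≤ |u s i - u t i|) :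
    radE (fun ε => ⨆ t, (g t + ∑ i, sgn (ε i) * v t i)) ≤
      radE (fun ε => ⨆ t, (g t + ∑ i, sgn (ε i) * u t i)) := by
  induction m generalizing g B with
  | zero => simp [radE_zero]
  | succ m ih =>
    have hb : ∀ b t, |g t + sgn b * v t 0| ≤ B + C := fun b t =>
      (abs_add_le _ _).trans (add_le_add (hg t) (by rw [abs_mul, abs_sgn, one_mul]; exact hv t 0))
    have step : ∀ b : Bool,
        radE (fun ε => ⨆ t, (g t + sgn b * v t 0 + ∑ i : Fin m, sgn (ε i) * v t i.succ)) ≤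
        radE (fun ε => ⨆ t, (g t + sgn b * v t 0 + ∑ i : Fin m, sgn (ε i) * u t i.succ)) :=
      fun b => ih (fun t i => u t i.succ) (fun t i => v t i.succ) (fun t => g t + sgn b * v t 0)
        (fun t i => hu t _) (hb b) (fun t i => hv t _) (fun s t i => huv s t _)
    rw [radE_succ, radE_succ]
    simp only [Fin.sum_univ_succ, Fin.cons_zero, Fin.cons_succ, ← add_assoc]
    refine div_le_div_of_nonneg_right ?_ two_pos.le
    refine (add_le_add (step true) (step false)).trans ?_
    rw [← radE_add, ← radE_add]
    refine radE_mono fun ε => ?_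
    have hbd : ∀ b t, |(g t + ∑ i : Fin m, sgn (ε i) * u t i.succ) + sgn b * u t 0| ≤
        B + m * C + C := fun b t =>
      (abs_add_le _ _).trans (add_le_add ((abs_add_le _ _).trans (add_le_add (hg t)
        (abs_signed_sum_le ε _ fun i => hu t _)))
        (by rw [abs_mul, abs_sgn, one_mul]; exact hu t 0))
    have := ciSup_add_ciSup_contract (fun t => g t + ∑ i : Fin m, sgn (ε i) * u t i.succ)
      (fun t => u t 0) (fun t => v t 0) (fun s t => huv s t 0)
      (bddAbove_of_abs_le (C := B + m * C + C) fun t => by simpa [sgn] using hbd true t)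
      (bddAbove_of_abs_le (C := B + m * C + C) fun t => by
        simpa [sgn, sub_eq_add_neg] using hbd false t)
    simp only [sgn, if_true, Bool.false_eq_true, if_false, one_mul, neg_one_mul] at this ⊢
    convert this using 4 <;> ring

/-- A supremum over a separable space of functions continuous in the index is measurable. -/
lemma measurable_ciSup_of_continuous {T Ω : Type*} [TopologicalSpace T]
    [TopologicalSpace.SeparableSpace T] [MeasurableSpace Ω] {f : T → Ω → ℝ}
    (hc : ∀ ω, Continuous fun t => f t ω) (hm : ∀ t, Measurable (f t)) :
    Measurable fun ω => ⨆ t, f t ω := by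
  obtain ⟨s, hs, hd⟩ := TopologicalSpace.exists_countable_dense T
  have : Countable s := hs
  simp_rw [← fun ω => hd.ciSup' (hc ω)]
  exact Measurable.iSup fun t => hm t

lemma MeasureTheory.MeasurePreserving.integral_comp_of_aestronglyMeasurable
    {Ω Ω' : Type*} [MeasurableSpace Ω] [MeasurableSpace Ω'] {P : Measure Ω} {Q : Measure Ω'}
    {f : Ω → Ω'} (hf : MeasurePreserving f P Q) {g : Ω' → ℝ} (hg : AEStronglyMeasurable g Q) :
    ∫ ω, g (f ω) ∂P = ∫ ω, g ω ∂Q := by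
  rw [← hf.map_eq] at hg ⊢
  exact (integral_map hf.aemeasurable hg).symm

lemma integrable_of_abs_le {Ω : Type*} [MeasurableSpace Ω] {P : Measure Ω} [IsFiniteMeasure P]
    {f : Ω → ℝ} {C : ℝ} (hm : Measurable f) (h : ∀ ω, |f ω| ≤ C) : Integrable f P :=
  Integrable.of_bound hm.aestronglyMeasurable C (ae_of_all _ h)

/-- A bound on an integral through an integrable majorant, the function itself being possibly
non-integrable. -/
lemma integral_le_of_le_of_nonneg {Ω : Type*} [MeasurableSpace Ω] {P : Measure Ω} {f g : Ω → ℝ}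
    {c : ℝ} (hg : Integrable g P) (h : ∀ ω, f ω ≤ g ω) (hgc : ∫ ω, g ω ∂P ≤ c) (hc : 0 ≤ c) :
    ∫ ω, f ω ∂P ≤ c := by
  by_cases hf : Integrable f P
  · exact (integral_mono hf hg h).trans hgc
  · rwa [integral_undef hf]

lemma radE_ciSup_nonneg {T : Type*} [Nonempty T] {m : ℕ} (a : T → Fin m → ℝ) {C : ℝ}
    (ha : ∀ t i, |a t i| ≤ C) : 0 ≤ radE (fun ε => ⨆ t, ∑ i, sgn (ε i) * a t i) := by
  obtain ⟨t⟩ := ‹Nonempty T›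
  have hle : ∀ ε : Fin m → Bool, ∑ i, sgn (ε i) * a t i ≤ ⨆ t, ∑ i, sgn (ε i) * a t i :=
    fun ε => le_ciSup (bddAbove_of_abs_le fun t => abs_signed_sum_le ε _ (ha t)) t
  have h0 : 0 ≤ radE (fun ε => (⨆ t, ∑ i, sgn (ε i) * a t i)
      + ⨆ t, ∑ i, sgn (!(ε i)) * a t i) := by
    rw [← radE_const (m := m) 0]
    refine radE_mono fun ε => ?_
    have h1 := hle ε
    have h2 := hle fun i => !(ε i)
    simp only [sgn_not, neg_mul, sum_neg_distrib] at h1 h2 ⊢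
    linarith
  rw [radE_add, radE_not fun ε => ⨆ t, ∑ i, sgn (ε i) * a t i] at h0
  linarith

lemma abs_sum_diff_le {T W : Type*} {h : T → W → ℝ} {B : ℝ} {m : ℕ}
    (hB : ∀ t w, |h t w| ≤ B) (t : T) (w w' : Fin m → W) :
    |∑ i, (h t (w i) - h t (w' i))| ≤ m * (2 * B) := by
  have := abs_signed_sum_le (fun _ => true) (fun i => h t (w i) - h t (w' i)) (C := 2 * B)
    (fun i => (abs_sub _ _).trans (by linarith [hB t (w i), hB t (w' i)]))
  simpa [sgn] using this

section Symmetrization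

variable {T W : Type*} [TopologicalSpace T] [TopologicalSpace.SeparableSpace T]
  [MeasurableSpace W] {h : T → W → ℝ} {B : ℝ}

lemma measurable_ciSup_signed_sum {m : ℕ} (hc : ∀ w, Continuous fun t => h t w)
    (hm : ∀ t, Measurable (h t)) (ε : Fin m → Bool) :
    Measurable fun w : Fin m → W => ⨆ t, ∑ i, sgn (ε i) * h t (w i) :=
  measurable_ciSup_of_continuous (f := fun t (w : Fin m → W) => ∑ i, sgn (ε i) * h t (w i))
    (fun w => by have := hc; fun_prop) (fun t => by have := hm t; fun_prop)

lemma measurable_ciSup_diff {m : ℕ} (hc : ∀ w, Continuous fun t => h t w)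
    (hm : ∀ t, Measurable (h t)) :
    Measurable fun q : (Fin m → W) × (Fin m → W) => ⨆ t, ∑ i, (h t (q.2 i) - h t (q.1 i)) :=
  measurable_ciSup_of_continuous
    (f := fun t (q : (Fin m → W) × (Fin m → W)) => ∑ i, (h t (q.2 i) - h t (q.1 i)))
    (fun w => by have := hc; fun_prop) (fun t => by have := hm t; fun_prop)

variable [Nonempty T]

lemma integrable_ciSup_signed_sum {m : ℕ} (ν : Measure W) [IsProbabilityMeasure ν]
    (hc : ∀ w, Continuous fun t => h t w)
    (hm : ∀ t, Measurable (h t)) (hB : ∀ t w, |h t w| ≤ B) (ε : Fin m → Bool) :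
    Integrable (fun w : Fin m → W => ⨆ t, ∑ i, sgn (ε i) * h t (w i))
      (Measure.pi fun _ => ν) :=
  integrable_of_abs_le (C := m * B) (measurable_ciSup_signed_sum hc hm ε) fun _ =>
    abs_ciSup_le fun t => abs_signed_sum_le ε _ fun _ => hB t _

lemma integrable_ciSup_diff {m : ℕ} (ν : Measure W) [IsProbabilityMeasure ν]
    (hc : ∀ w, Continuous fun t => h t w)
    (hm : ∀ t, Measurable (h t)) (hB : ∀ t w, |h t w| ≤ B) :
    Integrable (fun q : (Fin m → W) × (Fin m → W) => ⨆ t, ∑ i, (h t (q.2 i) - h t (q.1 i)))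
      ((Measure.pi fun _ => ν).prod (Measure.pi fun _ => ν)) :=
  integrable_of_abs_le (measurable_ciSup_diff hc hm) fun _ =>
    abs_ciSup_le fun t => abs_sum_diff_le hB t _ _

/-- Exchanging the two samples in the coordinates where `ε` is false preserves the law. -/
lemma measurePreserving_coordSwap {m : ℕ} (ν : Measure W) [IsProbabilityMeasure ν]
    (ε : Fin m → Bool) :
    MeasurePreserving (fun q : (Fin m → W) × (Fin m → W) =>
        ((fun i => if ε i then q.1 i else q.2 i, fun i => if ε i then q.2 i else q.1 i) :
          (Fin m → W) × (Fin m → W)))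
      ((Measure.pi fun _ => ν).prod (Measure.pi fun _ => ν))
      ((Measure.pi fun _ => ν).prod (Measure.pi fun _ => ν)) := by
  have hE := measurePreserving_arrowProdEquivProdArrow W W (Fin m) (fun _ => ν) (fun _ => ν)
  have hs : MeasurePreserving (fun (u : Fin m → W × W) i => if ε i then u i else (u i).swap)
      (Measure.pi fun _ => ν.prod ν) (Measure.pi fun _ => ν.prod ν) := by
    refine measurePreserving_pi (fun _ : Fin m => ν.prod ν) (fun _ => ν.prod ν)
      (f := fun i x => if ε i then x else x.swap) fun i => ?_
    by_cases hi : ε i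
    · simp only [hi, if_true]
      exact MeasurePreserving.id _
    · simpa [hi] using Measure.measurePreserving_swap
  convert hE.comp (hs.comp (hE.symm _)) using 1
  funext q
  ext i
  · by_cases hi : ε i <;> simp [hi, MeasurableEquiv.arrowProdEquivProdArrow,
      Equiv.arrowProdEquivProdArrow]
  · by_cases hi : ε i <;> simp [hi, MeasurableEquiv.arrowProdEquivProdArrow,
      Equiv.arrowProdEquivProdArrow]

/-- Symmetrization for two independent samples. -/
lemma integral_ciSup_diff_le {m : ℕ} (ν : Measure W) [IsProbabilityMeasure ν]
    (hc : ∀ w, Continuous fun t => h t w)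
    (hm : ∀ t, Measurable (h t)) (hB : ∀ t w, |h t w| ≤ B) :
    ∫ q, (⨆ t, ∑ i, (h t (q.2 i) - h t (q.1 i)))
        ∂((Measure.pi fun _ : Fin m => ν).prod (Measure.pi fun _ : Fin m => ν)) ≤
      2 * ∫ w, radE (fun ε => ⨆ t, ∑ i, sgn (ε i) * h t (w i))
        ∂(Measure.pi fun _ : Fin m => ν) := by
  set P := Measure.pi fun _ : Fin m => ν
  set A : (Fin m → Bool) → ℝ := fun ε => ∫ w, (⨆ t, ∑ i, sgn (ε i) * h t (w i)) ∂P
  have hint := fun ε => integrable_ciSup_signed_sum (m := m) ν hc hm hB ε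
  have hAE : ∫ w, radE (fun ε => ⨆ t, ∑ i, sgn (ε i) * h t (w i)) ∂P = radE A := by
    simp only [radE]
    rw [integral_div, integral_finsetSum _ fun ε _ => hint ε]
  have key : ∀ ε : Fin m → Bool,
      ∫ q, (⨆ t, ∑ i, (h t (q.2 i) - h t (q.1 i))) ∂(P.prod P) ≤
        A ε + A (fun i => !(ε i)) := by
    intro ε
    rw [← (measurePreserving_coordSwap ν ε).integral_comp_of_aestronglyMeasurable
      (measurable_ciSup_diff hc hm).aestronglyMeasurable]
    have i2 : Integrable (fun q : (Fin m → W) × (Fin m → W) =>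
        ⨆ t, ∑ i, sgn (ε i) * h t (q.2 i)) (P.prod P) := (hint ε).comp_snd P
    have i1 : Integrable (fun q : (Fin m → W) × (Fin m → W) =>
        ⨆ t, ∑ i, sgn (!(ε i)) * h t (q.1 i)) (P.prod P) := (hint fun i => !(ε i)).comp_fst P
    have e2 : ∫ q, (⨆ t, ∑ i, sgn (ε i) * h t (q.2 i)) ∂(P.prod P) = A ε :=
      measurePreserving_snd.integral_comp_of_aestronglyMeasurable (hint ε).1
    have e1 : ∫ q, (⨆ t, ∑ i, sgn (!(ε i)) * h t (q.1 i)) ∂(P.prod P) = A fun i => !(ε i) :=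
      measurePreserving_fst.integral_comp_of_aestronglyMeasurable (hint fun i => !(ε i)).1
    rw [← e1, ← e2, ← integral_add i2 i1]
    refine integral_mono ?_ (i2.add i1) fun q => ?_
    · exact (measurePreserving_coordSwap ν ε).integrable_comp_of_integrable
        (integrable_ciSup_diff ν hc hm hB)
    · refine ciSup_le fun t => ?_
      have b2 : ∑ i, sgn (ε i) * h t (q.2 i) ≤ ⨆ t, ∑ i, sgn (ε i) * h t (q.2 i) :=
        le_ciSup (bddAbove_of_abs_le fun t => abs_signed_sum_le ε _ fun i => hB t (q.2 i)) t
      have b1 : ∑ i, sgn (!(ε i)) * h t (q.1 i) ≤ ⨆ t, ∑ i, sgn (!(ε i)) * h t (q.1 i) :=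
        le_ciSup (bddAbove_of_abs_le fun t =>
          abs_signed_sum_le (fun i => !(ε i)) _ fun i => hB t (q.1 i)) t
      refine le_trans (le_of_eq ?_) (add_le_add b2 b1)
      rw [← sum_add_distrib]
      refine sum_congr rfl fun i _ => ?_
      by_cases hi : ε i <;> simp [sgn, hi] <;> ring
  rw [hAE, two_mul]
  nth_rewrite 2 [← radE_not]
  rw [← radE_add]
  refine (radE_const (m := m) _).symm.le.trans (radE_mono key)

/-- The expected deviation of an average over a sample from its mean, expressed through an
independent copy of the sample. -/
lemma mean_sub_sum_le {m : ℕ} (ν : Measure W) [IsProbabilityMeasure ν]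
    (hc : ∀ w, Continuous fun t => h t w)
    (hm : ∀ t, Measurable (h t)) (hB : ∀ t w, |h t w| ≤ B) (t : T) (w : Fin m → W) :
    m * (∫ x, h t x ∂ν) - ∑ i, h t (w i) ≤
      ∫ w', (⨆ t, ∑ i, (h t (w' i) - h t (w i))) ∂(Measure.pi fun _ : Fin m => ν) := by
  have hi : ∀ i, Integrable (fun w' : Fin m → W => h t (w' i)) (Measure.pi fun _ => ν) :=
    fun i => integrable_of_abs_le ((hm t).comp (measurable_pi_apply i)) fun w' => hB t _
  have hs : Integrable (fun w' : Fin m → W => ∑ i, (h t (w' i) - h t (w i)))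
      (Measure.pi fun _ => ν) :=
    integrable_finsetSum _ fun i _ => (hi i).sub (integrable_const _)
  have heq : m * (∫ x, h t x ∂ν) - ∑ i, h t (w i) =
      ∫ w', (∑ i, (h t (w' i) - h t (w i))) ∂(Measure.pi fun _ : Fin m => ν) := by
    have : ∀ i, ∫ w', h t (w' i) ∂(Measure.pi fun _ : Fin m => ν) = ∫ x, h t x ∂ν := fun i =>
      (measurePreserving_eval (fun _ : Fin m => ν) i).integral_comp_of_aestronglyMeasurable
        (hm t).aestronglyMeasurable
    rw [integral_finsetSum (f := fun i (w' : Fin m → W) => h t (w' i) - h t (w i)) _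
      fun i _ => (hi i).sub (integrable_const _)]
    simp_rw [fun i => integral_sub (hi i) (integrable_const (h t (w i))), this]
    simp
  rw [heq]
  have hmeas : Measurable fun w' : Fin m → W => ⨆ t, ∑ i, (h t (w' i) - h t (w i)) :=
    (measurable_ciSup_diff hc hm).comp (measurable_const.prodMk measurable_id)
  refine integral_mono hs (integrable_of_abs_le hmeas fun w' =>
    abs_ciSup_le fun t => abs_sum_diff_le hB t _ _) fun w' => ?_
  exact le_ciSup (f := fun t => ∑ i, (h t (w' i) - h t (w i)))
    (bddAbove_of_abs_le fun t => abs_sum_diff_le hB t w' w) t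

end Symmetrization

section UStatistic

/-- Averaging a function of an ordered pair of distinct points over all permutations. -/
lemma sum_perm_pair {α : Type*} [Fintype α] [DecidableEq α] (g : α → α → ℝ) {a b : α}
    (hab : a ≠ b) :
    (Fintype.card α : ℝ) * (Fintype.card α - 1) * ∑ σ : Equiv.Perm α, g (σ a) (σ b) =
      (Fintype.card (Equiv.Perm α)) * ∑ x ∈ (univ : Finset α).offDiag, g x.1 x.2 := by
  have htrans : ∀ x ∈ (univ : Finset α).offDiag,
      ∑ σ : Equiv.Perm α, g (σ x.1) (σ x.2) = ∑ σ : Equiv.Perm α, g (σ a) (σ b) := by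
    intro x hx
    obtain ⟨τ, h1, h2⟩ := MulAction.is_two_pretransitive_iff.1
      (Equiv.Perm.isMultiplyPretransitive α 2) hab (mem_offDiag.1 hx).2.2
    rw [← Equiv.sum_comp (Equiv.mulRight τ) fun σ : Equiv.Perm α => g (σ a) (σ b)]
    simp only [Equiv.Perm.smul_def] at h1 h2
    simp [h1, h2]
  have hinv : ∀ σ : Equiv.Perm α, ∑ x ∈ (univ : Finset α).offDiag, g (σ x.1) (σ x.2) =
      ∑ x ∈ (univ : Finset α).offDiag, g x.1 x.2 := fun σ =>
    sum_equiv (σ.prodCongr σ) (fun x => by simp) (fun x _ => by simp)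
  have hsum := sum_congr rfl htrans
  rw [sum_comm, sum_congr rfl fun σ _ => hinv σ, sum_const, sum_const, card_univ, offDiag_card,
    card_univ, nsmul_eq_mul, nsmul_eq_mul, Nat.cast_sub (Nat.le_mul_self _)] at hsum
  rw [hsum]
  push_cast
  ring

lemma sum_offDiag_min_max {n : ℕ} (H : Fin n → Fin n → ℝ) :
    ∑ x ∈ (univ : Finset (Fin n)).offDiag, H (min x.1 x.2) (max x.1 x.2) =
      2 * ∑ i, ∑ j, if i < j then H i j else 0 := by
  have hfilter : (univ : Finset (Fin n)).offDiag = univ.filter fun x => x.1 ≠ x.2 := by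
    ext; simp
  rw [hfilter, sum_filter, Fintype.sum_prod_type, two_mul]
  nth_rewrite 3 [sum_comm]
  simp only [← sum_add_distrib]
  refine sum_congr rfl fun i _ => sum_congr rfl fun j _ => ?_
  rcases lt_trichotomy i j with h | h | h
  · simp [h.ne, h, h.le, h.not_gt]
  · simp [h]
  · simp [h.ne', h, h.le, h.not_gt]

variable {Z : Type*} [MeasurableSpace Z]

/-- Splitting an i.i.d. sample into disjoint pairs gives an i.i.d. sample of pairs. -/
lemma measurePreserving_pairs {m : ℕ} {ι : Type*} [Fintype ι] (D : Measure Z)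
    [IsProbabilityMeasure D] (e : Fin m ⊕ Fin m ≃ ι) :
    MeasurePreserving (fun (S : ι → Z) (i : Fin m) => (S (e (.inl i)), S (e (.inr i))))
      (Measure.pi fun _ => D) (Measure.pi fun _ => D.prod D) := by
  have h1 := (measurePreserving_piCongrLeft (fun _ : ι => D) e).symm
  have h2 := measurePreserving_sumPiEquivProdPi (fun _ : Fin m ⊕ Fin m => D)
  have h3 := (measurePreserving_arrowProdEquivProdArrow Z Z (Fin m)
    (fun _ => D) (fun _ => D)).symm
  exact h3.comp (h2.comp h1)

lemma measurePreserving_sortedPairs {m n : ℕ} (D : Measure Z)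
    [IsProbabilityMeasure D] (e : Fin m ⊕ Fin m ≃ Fin n) :
    MeasurePreserving (fun (S : Fin n → Z) (i : Fin m) =>
        (S (min (e (.inl i)) (e (.inr i))), S (max (e (.inl i)) (e (.inr i)))))
      (Measure.pi fun _ => D) (Measure.pi fun _ => D.prod D) := by
  have hs : MeasurePreserving
      (fun (u : Fin m → Z × Z) i => if e (.inl i) ≤ e (.inr i) then u i else (u i).swap)
      (Measure.pi fun _ => D.prod D) (Measure.pi fun _ => D.prod D) := by
    refine measurePreserving_pi (fun _ : Fin m => D.prod D) (fun _ => D.prod D)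
      (f := fun i x => if e (.inl i) ≤ e (.inr i) then x else x.swap) fun i => ?_
    by_cases hi : e (.inl i) ≤ e (.inr i)
    · simp only [hi, if_true]
      exact MeasurePreserving.id _
    · simpa only [hi, if_false] using Measure.measurePreserving_swap
  convert hs.comp (measurePreserving_pairs D e) using 1
  funext S i
  rcases le_or_gt (e (.inl i)) (e (.inr i)) with hi | hi
  · simp [hi]
  · simp [hi.le, hi.not_ge]

/-- A U-statistic with ordered pairs is an average over permutations of averages over
disjoint pairs. -/
lemma uStatistic_eq_perm_average {m n : ℕ} (hn : 2 ≤ n) (e : Fin m ⊕ Fin m ≃ Fin n)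
    (H : Fin n → Fin n → ℝ) :
    ∑ σ : Equiv.Perm (Fin n), ∑ i : Fin m,
        H (min (σ (e (.inl i))) (σ (e (.inr i)))) (max (σ (e (.inl i))) (σ (e (.inr i)))) =
      Fintype.card (Equiv.Perm (Fin n)) * (m * (2 / ((n : ℝ) * ((n : ℝ) - 1)) *
        ∑ i, ∑ j, if i < j then H i j else 0)) := by
  have hn' : (2 : ℝ) ≤ n := by exact_mod_cast hn
  have hn1 : (n : ℝ) - 1 ≠ 0 := by linarith
  have hn0 : (n : ℝ) ≠ 0 := by linarith
  have hi : ∀ i : Fin m, ∑ σ : Equiv.Perm (Fin n),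
      H (min (σ (e (.inl i))) (σ (e (.inr i)))) (max (σ (e (.inl i))) (σ (e (.inr i)))) =
      Fintype.card (Equiv.Perm (Fin n)) * (2 / ((n : ℝ) * ((n : ℝ) - 1)) *
        ∑ i, ∑ j, if i < j then H i j else 0) := by
    intro i
    have := sum_perm_pair (fun a b => H (min a b) (max a b))
      (a := e (.inl i)) (b := e (.inr i)) (by simp)
    rw [sum_offDiag_min_max, Fintype.card_fin] at this
    field_simp
    linarith
  rw [sum_comm, sum_congr rfl fun i _ => hi i]
  simp
  ring

variable {T : Type*} [TopologicalSpace T] [TopologicalSpace.SeparableSpace T] [Nonempty T]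
  {h : T → Z × Z → ℝ} {B : ℝ}

/-- Symmetrization for the uniform deviation of a U-statistic of order two. -/
lemma integral_ciSup_uStatistic_le {m n : ℕ} (hn : 2 ≤ n) (e : Fin m ⊕ Fin m ≃ Fin n)
    (D : Measure Z) [IsProbabilityMeasure D]
    (hc : ∀ w, Continuous fun t => h t w)
    (hm : ∀ t, Measurable (h t)) (hB : ∀ t w, |h t w| ≤ B) :
    ∫ S, (⨆ t, ((∫ w, h t w ∂(D.prod D)) - 2 / ((n : ℝ) * ((n : ℝ) - 1)) *
          ∑ i : Fin n, ∑ j : Fin n, if i < j then h t (S i, S j) else 0))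
        ∂(Measure.pi fun _ : Fin n => D) ≤
      2 / m * ∫ w, radE (fun ε => ⨆ t, ∑ i, sgn (ε i) * h t (w i))
        ∂(Measure.pi fun _ : Fin m => D.prod D) := by
  set P := Measure.pi fun _ : Fin m => D.prod D
  have hmn : m + m = n := by simpa using Fintype.card_congr e
  have hm0 : (0 : ℝ) < m := by
    have : 0 < m := by omega
    exact_mod_cast this
  set N : ℝ := ((Fintype.card (Equiv.Perm (Fin n)) : ℕ) : ℝ) with hN
  have hN0 : 0 < N := by simp only [hN, Nat.cast_pos, Fintype.card_pos]
  set Ψ : (Fin m → Z × Z) → ℝ := fun w => ∫ w', (⨆ t, ∑ i, (h t (w' i) - h t (w i))) ∂P with hΨ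
  have hdiff := integrable_ciSup_diff (m := m) (D.prod D) hc hm hB
  have hΨint : Integrable Ψ P := hdiff.integral_prod_left
  have hΨle : ∫ w, Ψ w ∂P ≤
      2 * ∫ w, radE (fun ε => ⨆ t, ∑ i, sgn (ε i) * h t (w i)) ∂P := by
    rw [hΨ, ← integral_prod _ hdiff]
    exact integral_ciSup_diff_le (D.prod D) hc hm hB
  let pr : Equiv.Perm (Fin n) → (Fin n → Z) → Fin m → Z × Z := fun σ S i =>
    (S (min (σ (e (.inl i))) (σ (e (.inr i)))), S (max (σ (e (.inl i))) (σ (e (.inr i)))))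
  have hpr : ∀ σ, MeasurePreserving (pr σ) (Measure.pi fun _ => D) P :=
    fun σ => measurePreserving_sortedPairs D (e.trans σ)
  have hprint : ∀ σ, Integrable (fun S => Ψ (pr σ S)) (Measure.pi fun _ => D) :=
    fun σ => (hpr σ).integrable_comp_of_integrable hΨint
  refine integral_le_of_le_of_nonneg (g := fun S => (∑ σ, Ψ (pr σ S)) / (N * m))
    ((integrable_finsetSum _ fun σ _ => hprint σ).div_const _) (fun S => ciSup_le fun t => ?_) ?_ ?_
  · rw [le_div_iff₀ (by positivity)]
    calc _ = ∑ σ : Equiv.Perm (Fin n), (m * (∫ w, h t w ∂(D.prod D)) - ∑ i, h t (pr σ S i)) := by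
          rw [sum_sub_distrib, uStatistic_eq_perm_average hn e fun i j => h t (S i, S j)]
          simp only [sum_const, card_univ, nsmul_eq_mul]
          ring
      _ ≤ _ := sum_le_sum fun σ _ => mean_sub_sum_le (D.prod D) hc hm hB t (pr σ S)
  · rw [integral_div, integral_finsetSum _ fun σ _ => hprint σ,
      sum_congr rfl fun σ _ => (hpr σ).integral_comp_of_aestronglyMeasurable hΨint.1]
    simp only [sum_const, card_univ, nsmul_eq_mul]
    rw [mul_div_mul_left _ _ hN0.ne', div_mul_eq_mul_div]
    gcongr
  · exact mul_nonneg (by positivity) (integral_nonneg fun w =>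
      radE_ciSup_nonneg (fun t i => h t (w i)) fun t i => hB t (w i))

end UStatistic

section Ball

variable {p : ℕ}

lemma l2norm_nonneg (v : Fin p → ℝ) : 0 ≤ l2norm v := Real.sqrt_nonneg _

lemma ip_le (u v : Fin p → ℝ) : ip u v ≤ l2norm u * l2norm v :=
  Real.sum_mul_le_sqrt_mul_sqrt _ _ _

lemma abs_ip_le (u v : Fin p → ℝ) : |ip u v| ≤ l2norm u * l2norm v := by
  refine abs_le'.2 ⟨ip_le u v, ?_⟩
  have := ip_le u (-v)
  simpa [ip, l2norm] using this

lemma l2norm_le_of_abs_le {u v : Fin p → ℝ} (h : ∀ k, |u k| ≤ v k) : l2norm u ≤ l2norm v :=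
  Real.sqrt_le_sqrt (sum_le_sum fun k _ =>
    sq_le_sq' (by linarith [(abs_le.1 (h k)).1]) (abs_le.1 (h k)).2)

lemma continuous_ip (v : Fin p → ℝ) : Continuous fun u : Fin p → ℝ => ip u v := by
  unfold ip
  fun_prop

lemma sum_mul_ip {m : ℕ} (c : Fin m → ℝ) (u : Fin p → ℝ) (z : Fin m → Fin p → ℝ) :
    ∑ i, c i * ip u (z i) = ip u fun k => ∑ i, c i * z i k := by
  simp only [ip, mul_sum]
  rw [sum_comm]
  exact sum_congr rfl fun _ _ => sum_congr rfl fun _ _ => by ring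

instance nonempty_l2ball (r : ℝ) [hr : Fact (0 < r)] :
    Nonempty {μ : Fin p → ℝ // l2norm μ ≤ r} :=
  ⟨0, by simpa [l2norm] using hr.out.le⟩

/-- The Rademacher complexity of linear functionals over an L2 ball. -/
lemma radE_ciSup_ip_le {m : ℕ} {r : ℝ} (hr : 0 < r) (z : Fin m → Fin p → ℝ) (b : Fin p → ℝ)
    (hz : ∀ i k, |z i k| ≤ b k) :
    radE (fun ε => ⨆ μ : {μ : Fin p → ℝ // l2norm μ ≤ r}, ∑ i, sgn (ε i) * ip μ.1 (z i)) ≤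
      r * (√m * l2norm b) := by
  have : Fact (0 < r) := ⟨hr⟩
  calc _ ≤ radE fun ε : Fin m → Bool => r * l2norm fun k => ∑ i, sgn (ε i) * z i k := by
        refine radE_mono fun ε => ciSup_le fun μ => ?_
        rw [sum_mul_ip]
        exact (ip_le _ _).trans (mul_le_mul_of_nonneg_right μ.2 (l2norm_nonneg _))
    _ = r * radE fun ε : Fin m → Bool => l2norm fun k => ∑ i, sgn (ε i) * z i k :=
        radE_const_mul _ _
    _ ≤ r * √(radE fun ε : Fin m → Bool => ∑ k, (∑ i, sgn (ε i) * z i k) ^ 2) :=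
        mul_le_mul_of_nonneg_left (radE_sqrt_le _ fun ε => by positivity) hr.le
    _ = r * √(∑ k, ∑ i, z i k ^ 2) := by
        have h : ∀ k, radE (fun ε : Fin m → Bool => (∑ i, sgn (ε i) * z i k) ^ 2) =
            ∑ i, z i k ^ 2 := fun k => by simpa using radE_sq (fun i => z i k) 0
        congr 2
        rw [← sum_congr rfl fun k _ => h k]
        simp only [radE, ← sum_div]
        rw [sum_comm]
    _ ≤ r * √(m * ∑ k, b k ^ 2) := by
        refine mul_le_mul_of_nonneg_left (Real.sqrt_le_sqrt ?_) hr.le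
        rw [mul_sum]
        refine sum_le_sum fun k _ => ?_
        calc ∑ i, z i k ^ 2 ≤ ∑ _i : Fin m, b k ^ 2 := sum_le_sum fun i _ =>
              sq_le_sq' (by linarith [(abs_le.1 (hz i k)).1]) (abs_le.1 (hz i k)).2
          _ = m * b k ^ 2 := by simp
    _ = r * (√m * l2norm b) := by rw [Real.sqrt_mul (Nat.cast_nonneg _), l2norm]

end Ball

section Hinge

variable {X : Type*} {p : ℕ} (K : Fin p → X → X → ℝ)

lemma hinge_lipschitz (u v : Fin p → ℝ) (w w' : X × Bool) :
    |hinge K u w w' - hinge K v w w'| ≤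
      |ip u (zmap K w.1 w'.1) - ip v (zmap K w.1 w'.1)| := by
  unfold hinge
  rw [max_comm 0, max_comm 0]
  refine (abs_max_sub_max_le_abs _ _ _).trans_eq ?_
  rw [sub_sub_sub_cancel_left, ← mul_sub, abs_mul, abs_mul, abs_sgn, abs_sgn, one_mul, one_mul,
    abs_sub_comm]

lemma abs_hinge_le (u : Fin p → ℝ) (w w' : X × Bool) :
    |hinge K u w w'| ≤ 1 + |ip u (zmap K w.1 w'.1)| := by
  unfold hinge
  rw [abs_of_nonneg (le_max_left _ _)]
  refine max_le (by positivity) ?_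
  rw [sub_eq_add_neg]
  gcongr
  refine (neg_le_abs _).trans_eq ?_
  rw [abs_mul, abs_mul, abs_sgn, abs_sgn, one_mul, one_mul]

lemma continuous_hinge (w w' : X × Bool) : Continuous fun u => hinge K u w w' := by
  unfold hinge
  have := continuous_ip (zmap K w.1 w'.1)
  fun_prop

variable [MeasurableSpace X] {K}

lemma measurable_ip_zmap (hKm : ∀ i, Measurable (fun w : X × X => K i w.1 w.2))
    (u : Fin p → ℝ) :
    Measurable fun w : (X × Bool) × (X × Bool) => ip u (zmap K w.1.1 w.2.1) := by
  unfold ip zmap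
  refine Finset.measurable_fun_sum _ fun i _ => Measurable.const_mul ?_ _
  exact (hKm i).comp (g := fun w : X × X => K i w.1 w.2)
    (f := fun w : (X × Bool) × (X × Bool) => (w.1.1, w.2.1)) (by fun_prop)

lemma measurable_hinge (hKm : ∀ i, Measurable (fun w : X × X => K i w.1 w.2))
    (u : Fin p → ℝ) :
    Measurable fun w : (X × Bool) × (X × Bool) => hinge K u w.1 w.2 := by
  unfold hinge
  have h1 := measurable_ip_zmap hKm u
  have h2 : Measurable sgn := measurable_from_top
  fun_prop

end Hinge

/-- the expected uniform deviation over the L2 ball is bounded by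
4/n times an expected Rademacher sup, and consequently by 2r‖κ‖₂√(2/n). -/
theorem stmt8 {X : Type*} [MeasurableSpace X] {p n : ℕ} (hn : 2 ≤ n) (hev : Even n)
    (K : Fin p → X → X → ℝ)
    (hKm : ∀ i, Measurable (fun w : X × X => K i w.1 w.2))
    (κ : Fin p → ℝ) (hκ : ∀ i, 0 < κ i)
    (hKb : ∀ i x x', |K i x x'| ≤ κ i ^ 2)
    (D : Measure (X × Bool)) [IsProbabilityMeasure D]
    (r : ℝ) (hr : 0 < r) :
    ((∫ S, (⨆ μ : {μ : Fin p → ℝ // l2norm μ ≤ r},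
          (trueRisk K D μ.1 - empRisk K S μ.1))
        ∂(Measure.pi fun _ : Fin n => D)) ≤
      (4 / (n : ℝ)) * ∫ S, radE (fun ε : Fin (n / 2) → Bool =>
          ⨆ μ : {μ : Fin p → ℝ // l2norm μ ≤ r},
            ∑ i : Fin (n / 2), sgn (ε i) *
              ip μ.1 (zmap K (S ⟨i.1, by have := i.isLt; omega⟩).1
                             (S ⟨n / 2 + i.1, by have := i.isLt; omega⟩).1))
        ∂(Measure.pi fun _ : Fin n => D)) ∧
    (∫ S, (⨆ μ : {μ : Fin p → ℝ // l2norm μ ≤ r},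
          (trueRisk K D μ.1 - empRisk K S μ.1))
        ∂(Measure.pi fun _ : Fin n => D)) ≤
      2 * r * l2norm (fun i => κ i ^ 2) * Real.sqrt (2 / (n : ℝ)) := by
  have : Fact (0 < r) := ⟨hr⟩
  have hmn : n / 2 + n / 2 = n := by obtain ⟨k, hk⟩ := hev; omega
  have hm0 : 0 < n / 2 := by omega
  have hmR : (0 : ℝ) < ((n / 2 : ℕ) : ℝ) := by exact_mod_cast hm0
  have hnR : (n : ℝ) = 2 * ((n / 2 : ℕ) : ℝ) := by
    nth_rewrite 1 [← hmn]
    push_cast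
    ring
  let b : Fin p → ℝ := fun i => κ i ^ 2
  let T := {μ : Fin p → ℝ // l2norm μ ≤ r}
  let C : ℝ := r * l2norm b
  let f : T → (X × Bool) × (X × Bool) → ℝ := fun μ w => ip μ.1 (zmap K w.1.1 w.2.1)
  let h : T → (X × Bool) × (X × Bool) → ℝ := fun μ w => hinge K μ.1 w.1 w.2
  have hfB : ∀ t w, |f t w| ≤ C := fun t w =>
    (abs_ip_le _ _).trans (mul_le_mul t.2 (l2norm_le_of_abs_le fun k => hKb k _ _)
      (l2norm_nonneg _) hr.le)
  have hhB : ∀ t w, |h t w| ≤ 1 + C := fun t w =>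
    (abs_hinge_le K _ _ _).trans (by have := hfB t w; simp only [f] at this; linarith)
  have hfc : ∀ w, Continuous fun t => f t w := fun w =>
    (continuous_ip _).comp continuous_subtype_val
  have hhc : ∀ w, Continuous fun t => h t w := fun w =>
    (continuous_hinge K _ _).comp continuous_subtype_val
  have hfm : ∀ t, Measurable (f t) := fun t => measurable_ip_zmap hKm t.1
  have hhm : ∀ t, Measurable (h t) := fun t => measurable_hinge hKm t.1
  let e : Fin (n / 2) ⊕ Fin (n / 2) ≃ Fin n := finSumFinEquiv.trans (finCongr hmn)
  have hradint : ∀ g : T → (X × Bool) × (X × Bool) → ℝ, ∀ B : ℝ,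
      (∀ w, Continuous fun t => g t w) → (∀ t, Measurable (g t)) → (∀ t w, |g t w| ≤ B) →
      Integrable (fun w => radE (fun ε => ⨆ t, ∑ i, sgn (ε i) * g t (w i)))
        (Measure.pi fun _ : Fin (n / 2) => D.prod D) := fun g B hc hm hB =>
    (integrable_finsetSum _ fun ε _ => integrable_ciSup_signed_sum (D.prod D) hc hm hB ε).div_const _
  have hfint := hradint f C hfc hfm hfB
  have hpair : ∫ S, radE (fun ε : Fin (n / 2) → Bool => ⨆ μ : T,
        ∑ i, sgn (ε i) * f μ (S (e (.inl i)), S (e (.inr i)))) ∂(Measure.pi fun _ : Fin n => D) =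
      ∫ w, radE (fun ε => ⨆ t, ∑ i, sgn (ε i) * f t (w i))
        ∂(Measure.pi fun _ : Fin (n / 2) => D.prod D) :=
    (measurePreserving_pairs D e).integral_comp_of_aestronglyMeasurable hfint.1
  have hcontr : ∫ w, radE (fun ε => ⨆ t, ∑ i, sgn (ε i) * h t (w i))
        ∂(Measure.pi fun _ : Fin (n / 2) => D.prod D) ≤
      ∫ w, radE (fun ε => ⨆ t, ∑ i, sgn (ε i) * f t (w i))
        ∂(Measure.pi fun _ : Fin (n / 2) => D.prod D) := by
    refine integral_mono (hradint h (1 + C) hhc hhm hhB) hfint fun w => ?_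
    have := radE_contraction (fun (t : T) i => f t (w i)) (fun t i => h t (w i)) (fun _ => 0)
      (C := 1 + C) (B := 0) (fun t i => (hfB t _).trans (by linarith)) (by simp)
      (fun t i => hhB t _) (fun s t i => hinge_lipschitz K _ _ _ _)
    simpa only [zero_add] using this
  have hmain : (∫ S, (⨆ μ : T, (trueRisk K D μ.1 - empRisk K S μ.1))
        ∂(Measure.pi fun _ : Fin n => D)) ≤
      (4 / (n : ℝ)) * ∫ w, radE (fun ε => ⨆ t, ∑ i, sgn (ε i) * f t (w i))
        ∂(Measure.pi fun _ : Fin (n / 2) => D.prod D) := by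
    have hcoef : 4 / (n : ℝ) = 2 / ((n / 2 : ℕ) : ℝ) := by
      rw [hnR]
      field_simp
      norm_num
    rw [hcoef]
    exact (integral_ciSup_uStatistic_le hn e D hhc hhm hhB).trans
      (mul_le_mul_of_nonneg_left hcontr (by positivity))
  refine ⟨hmain.trans_eq (congrArg _ hpair.symm), hmain.trans ?_⟩
  have hrad : ∫ w, radE (fun ε => ⨆ t, ∑ i, sgn (ε i) * f t (w i))
        ∂(Measure.pi fun _ : Fin (n / 2) => D.prod D) ≤
      r * (√((n / 2 : ℕ) : ℝ) * l2norm b) := by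
    have := integral_mono (μ := Measure.pi fun _ : Fin (n / 2) => D.prod D) hfint
      (integrable_const (r * (√((n / 2 : ℕ) : ℝ) * l2norm b)))
      fun w => radE_ciSup_ip_le hr (fun i => zmap K (w i).1.1 (w i).2.1) b fun i k => hKb k _ _
    simpa using this
  refine (mul_le_mul_of_nonneg_left hrad (by positivity)).trans_eq ?_
  have hs : √(2 / (n : ℝ)) = (√((n / 2 : ℕ) : ℝ))⁻¹ := by
    rw [← Real.sqrt_inv, hnR]
    congr 1
    field_simp
  rw [hs, hnR]
  have hspos := Real.sqrt_pos.2 hmR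
  field_simp
  rw [Real.sq_sqrt hmR.le]
  ring
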